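/- Let N ≥ 1 and let (c_i)_{i=1}^{2N} be an alternating sequence of colors in {red, blue} (that is, c_{i+1} ≠ c_i for all i, indices mod 2N). Then there exist points s₁, …, s_{2N} ∈ ℝ/ℤ, in positive cyclic order, such that each s_i has color c_i and the closed arcs [s_i, s_{i+1}] (indices mod 2N) are R-intervals whose union is ℝ/ℤ, with consecutive arcs meeting only at shared endpoints. -/

import Mathlib

noncomputable section

open Set

/-- The circle `ℝ/ℤ`. -/
abbrev 𝕊 : Type := AddCircle (1 : ℝ)

/-- The natural projection from `ℝ` to the circle `ℝ/ℤ`. -/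
def tc (x : ℝ) : 𝕊 := (x : 𝕊)

/-- The closed arc on the circle from `a` to `b`, traversed in the positive direction;
arcs are parametrized by real lifts `a ≤ b ≤ a + 1` of their endpoints. -/
def cArc (a b : ℝ) : Set 𝕊 := tc '' Set.Icc a b

/-- The open arc on the circle from `a` to `b` (the interior of `cArc a b`). -/
def oArc (a b : ℝ) : Set 𝕊 := tc '' Set.Ioo a b

/-- The multiplication-by-`d` map `σ_d : ℝ/ℤ → ℝ/ℤ`, `σ_d t = d·t`. -/
def sigmaC (d : ℕ) (x : 𝕊) : 𝕊 := d • x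

/-- The three model arcs `(0,1)` (type A), `(0,2/3)` (type B), `(1/3,1)` (type C) of
R-intervals, given by the pairs of endpoints. -/
def rTypes : Set (ℝ × ℝ) := {(0, 1), (0, 2/3), (1/3, 1)}

/-- The arc `[a,b]` is an R-interval of type `J` with blow-up exponent `n`: the map `σ₃^n`
restricts to a homeomorphism from the open arc `(a,b)` onto the open model arc `J`. -/
def RIntervalWith (a b : ℝ) (J : ℝ × ℝ) (n : ℕ) : Prop :=
  a < b ∧ b ≤ a + 1 ∧ J ∈ rTypes ∧
    ∃ e : ↥(oArc a b) ≃ₜ ↥(oArc J.1 J.2),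
      ∀ x : ↥(oArc a b), (e x : 𝕊) = (sigmaC 3)^[n] ↑x

/-- The arc `[a,b]` is an R-interval. -/
def IsRInterval (a b : ℝ) : Prop := ∃ J n, RIntervalWith a b J n

/-- A point of the circle is colored red if its reduced form is `p/3^k` with `k ≥ 1` and
`p ≡ 1 (mod 3)`. -/
def RedT (x : 𝕊) : Prop :=
  ∃ (p : ℤ) (k : ℕ), 1 ≤ k ∧ p % 3 = 1 ∧ x = tc ((p : ℝ) / 3 ^ k)

/-- A point of the circle is colored blue if it is `0`, or if its reduced form is `p/3^k`
with `k ≥ 1` and `p ≡ 2 (mod 3)`. -/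
def BlueT (x : 𝕊) : Prop :=
  x = 0 ∨ ∃ (p : ℤ) (k : ℕ), 1 ≤ k ∧ p % 3 = 2 ∧ x = tc ((p : ℝ) / 3 ^ k)

/-- The two colors. -/
inductive TColor : Type
  | red : TColor
  | blue : TColor

/-- A point of the circle has a given color. -/
def HasTColor : TColor → 𝕊 → Prop
  | TColor.red => RedT
  | TColor.blue => BlueT

/-- The affine map `x ↦ 3 ^ n * x - m` of the real line. -/
def tripleAffine (n : ℕ) (m : ℤ) : ℝ ≃ₜ ℝ :=
  (Homeomorph.mulLeft₀ ((3 : ℝ) ^ n) (by positivity)).trans (Homeomorph.subRight (m : ℝ))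

theorem tripleAffine_apply (n : ℕ) (m : ℤ) (x : ℝ) :
    tripleAffine n m x = 3 ^ n * x - m := rfl

theorem sigmaC_iterate_tc (n : ℕ) (x : ℝ) : (sigmaC 3)^[n] (tc x) = tc (3 ^ n * x) := by
  induction n with
  | zero => simp
  | succ n ih =>
    rw [Function.iterate_succ_apply', ih, sigmaC, tc, tc, ← AddCircle.coe_nsmul]
    congr 1
    rw [nsmul_eq_mul]
    push_cast
    ring

theorem tc_sub_intCast (x : ℝ) (m : ℤ) : tc (x - m) = tc x := by
  unfold tc
  rw [AddCircle.coe_sub, sub_eq_self, AddCircle.coe_eq_zero_iff]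
  exact ⟨m, by simp⟩

/-- The projection restricts to a homeomorphism from a short open interval onto an open arc. -/
def ioHomeomorphOArc (a b : ℝ) (h : b ≤ a + 1) : Ioo a b ≃ₜ oArc a b :=
  (AddCircle.openPartialHomeomorphCoe (1 : ℝ) a).homeomorphOfImageSubsetSource
    (s := Ioo a b) (t := oArc a b) (Ioo_subset_Ioo_right h) rfl

theorem coe_ioHomeomorphOArc (a b : ℝ) (h : b ≤ a + 1) (x : Ioo a b) :
    (ioHomeomorphOArc a b h x : 𝕊) = tc x := rfl

theorem isRInterval_of_triple_affine {a b : ℝ} {J : ℝ × ℝ} (hJ : J ∈ rTypes) (n : ℕ) (m : ℤ)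
    (ha : 3 ^ n * a - m = J.1) (hb : 3 ^ n * b - m = J.2) : IsRInterval a b := by
  have hJ' : J.1 < J.2 ∧ J.2 ≤ J.1 + 1 := by
    rcases hJ with rfl | rfl | rfl <;> norm_num
  have h3 : (1 : ℝ) ≤ 3 ^ n := one_le_pow₀ (by norm_num)
  have hab : a < b := by
    by_contra! h
    nlinarith [mul_le_mul_of_nonneg_left h (zero_le_one.trans h3)]
  have hab' : b ≤ a + 1 := by nlinarith
  have himage : Ioo a b = tripleAffine n m ⁻¹' Ioo J.1 J.2 := by
    ext x
    simp only [mem_preimage, mem_Ioo, tripleAffine_apply, ← ha, ← hb, sub_lt_sub_iff_right]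
    rw [mul_lt_mul_iff_right₀ (by positivity), mul_lt_mul_iff_right₀ (by positivity)]
  let e : Ioo a b ≃ₜ Ioo J.1 J.2 := (tripleAffine n m).sets himage
  refine ⟨J, n, hab, hab', hJ, ((ioHomeomorphOArc a b hab').symm.trans e).trans
    (ioHomeomorphOArc J.1 J.2 hJ'.2), fun x => ?_⟩
  obtain ⟨y, rfl⟩ := (ioHomeomorphOArc a b hab').surjective x
  simp only [Homeomorph.trans_apply, Homeomorph.symm_apply_apply, coe_ioHomeomorphOArc,
    sigmaC_iterate_tc]
  exact tc_sub_intCast _ m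

theorem biUnion_cArc_eq_univ (s : ℕ → ℝ) {n : ℕ} (hn : 1 ≤ n) (h : s n = s 0 + 1) :
    (⋃ i ∈ Finset.range n, cArc (s i) (s (i + 1))) = univ := by
  have key : ∀ k, 1 ≤ k → ∀ x ∈ Icc (s 0) (s k), ∃ i < k, x ∈ Icc (s i) (s (i + 1)) := by
    intro k hk
    induction k, hk using Nat.le_induction with
    | base => exact fun x hx => ⟨0, by simp, hx⟩
    | succ k _ ih =>
      intro x hx
      rcases le_total x (s k) with hxk | hxk
      · obtain ⟨i, hi, hxi⟩ := ih x ⟨hx.1, hxk⟩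
        exact ⟨i, by omega, hxi⟩
      · exact ⟨k, by omega, hxk, hx.2⟩
  rw [eq_univ_iff_forall]
  intro z
  obtain ⟨x, hx, rfl⟩ : z ∈ ((↑) : ℝ → 𝕊) '' Icc (s 0) (s 0 + 1) := by
    rw [AddCircle.coe_image_Icc_eq]
    trivial
  rw [← h] at hx
  obtain ⟨i, hi, hxi⟩ := key n hn x hx
  exact mem_biUnion (Finset.mem_coe.2 (Finset.mem_range.2 hi)) ⟨x, hxi, rfl⟩

/-- Triadic points increasing to `1`: the even-indexed ones `1 - 1 / 3 ^ k` are blue and the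
odd-indexed ones `1 - 2 / 3 ^ (k + 1)` are red. -/
def triadicPt (i : ℕ) : ℝ :=
  if i % 2 = 0 then 1 - 1 / 3 ^ (i / 2) else 1 - 2 / 3 ^ (i / 2 + 1)

theorem triadicPt_even (k : ℕ) : triadicPt (2 * k) = 1 - 1 / 3 ^ k := by
  simp [triadicPt]

theorem triadicPt_odd (k : ℕ) : triadicPt (2 * k + 1) = 1 - 2 / 3 ^ (k + 1) := by
  rw [triadicPt, if_neg (by omega), show (2 * k + 1) / 2 = k by omega]

theorem blueT_triadicPt (k : ℕ) : BlueT (tc (triadicPt (2 * k))) := by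
  rw [triadicPt_even]
  rcases k with _ | k
  · left
    simp [tc]
  · refine Or.inr ⟨3 ^ (k + 1) - 1, k + 1, by omega, by rw [pow_succ]; omega, ?_⟩
    congr 1
    push_cast
    field_simp

theorem redT_triadicPt (k : ℕ) : RedT (tc (triadicPt (2 * k + 1))) := by
  rw [triadicPt_odd]
  refine ⟨3 ^ (k + 1) - 2, k + 1, by omega, by rw [pow_succ]; omega, ?_⟩
  congr 1
  push_cast
  field_simp

theorem isRInterval_triadicPt_succ (i : ℕ) :
    IsRInterval (triadicPt i) (triadicPt (i + 1)) := by
  obtain ⟨k, rfl | rfl⟩ : ∃ k, i = 2 * k ∨ i = 2 * k + 1 := ⟨i / 2, by omega⟩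
  · rw [triadicPt_even, triadicPt_odd]
    refine isRInterval_of_triple_affine (J := (0, 1)) (by simp [rTypes]) (k + 1)
      (3 ^ (k + 1) - 3) ?_ ?_ <;> push_cast <;> field_simp <;> ring
  · rw [show 2 * k + 1 + 1 = 2 * (k + 1) by ring, triadicPt_even, triadicPt_odd]
    refine isRInterval_of_triple_affine (J := (0, 1)) (by simp [rTypes]) (k + 1)
      (3 ^ (k + 1) - 2) ?_ ?_ <;> push_cast <;> field_simp <;> ring

theorem isRInterval_triadicPt_odd_one (k : ℕ) : IsRInterval (triadicPt (2 * k + 1)) 1 := by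
  rw [triadicPt_odd]
  refine isRInterval_of_triple_affine (J := (1 / 3, 1)) (by simp [rTypes]) k
    (3 ^ k - 1) ?_ ?_ <;> push_cast <;> field_simp <;> ring

theorem isRInterval_one_four_thirds : IsRInterval 1 (4 / 3) :=
  isRInterval_of_triple_affine (J := (0, 1)) (by simp [rTypes]) 1 3 (by norm_num) (by norm_num)

/-- The endpoints of the decomposition into `2 * N` arcs, followed by the first two endpoints of
its translate by `1`. -/
def cyclicPt (N i : ℕ) : ℝ :=
  if i < 2 * N then triadicPt i else if i = 2 * N then 1 else 4 / 3

theorem isRInterval_cyclicPt {N i : ℕ} (hi : i < 2 * N + 1) :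
    IsRInterval (cyclicPt N i) (cyclicPt N (i + 1)) := by
  unfold cyclicPt
  rcases lt_trichotomy (i + 1) (2 * N) with h | h | h
  · rw [if_pos (by omega), if_pos h]
    exact isRInterval_triadicPt_succ i
  · rw [if_pos (by omega), if_neg (by omega), if_pos h]
    obtain ⟨k, rfl⟩ : ∃ k, i = 2 * k + 1 := ⟨i / 2, by omega⟩
    exact isRInterval_triadicPt_odd_one k
  · rw [if_neg (by omega), if_pos (by omega), if_neg (by omega), if_neg (by omega)]
    exact isRInterval_one_four_thirds

theorem blueT_cyclicPt {N i : ℕ} (hi : i ≤ 2 * N) (h : i % 2 = 0) :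
    BlueT (tc (cyclicPt N i)) := by
  unfold cyclicPt
  split_ifs with h₁ h₂
  · simpa [show 2 * (i / 2) = i by omega] using blueT_triadicPt (i / 2)
  · left
    simp [tc]
  · omega

theorem redT_cyclicPt {N i : ℕ} (hi : i ≤ 2 * N) (h : i % 2 = 1) :
    RedT (tc (cyclicPt N i)) := by
  rw [cyclicPt, if_pos (by omega)]
  simpa [show 2 * (i / 2) + 1 = i by omega] using redT_triadicPt (i / 2)

theorem TColor.eq_of_ne_of_ne {x y z : TColor} (hx : x ≠ y) (hz : z ≠ y) : x = z := by
  cases x <;> cases y <;> cases z <;> simp_all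

theorem color_eq_of_alternating {n : ℕ} {c : ℕ → TColor} {u v : TColor} (huv : u ≠ v)
    (hc : ∀ i < n, c ((i + 1) % n) ≠ c i) (h0 : c 0 = u) :
    ∀ i < n, c i = if i % 2 = 0 then u else v := by
  intro i
  induction i with
  | zero => simpa using fun _ => h0
  | succ i ih =>
    intro hi
    have h := hc i (by omega)
    rw [Nat.mod_eq_of_lt hi, ih (by omega)] at h
    rcases Nat.mod_two_eq_zero_or_one i with h2 | h2
    · rw [if_pos h2] at h
      rw [if_neg (by omega)]
      exact TColor.eq_of_ne_of_ne h huv.symm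
    · rw [if_neg (by omega)] at h
      rw [if_pos (by omega)]
      exact TColor.eq_of_ne_of_ne h huv

/-- Let `N ≥ 1` and let `c₁, …, c_{2N}` be an alternating sequence of colors (cyclically).
Then there are points `s₁, …, s_{2N}` of `ℝ/ℤ` in positive cyclic order such that each `s_i`
has color `c_i` and the closed arcs `[s_i, s_{i+1}]` (indices mod `2N`) are R-intervals
whose union is `ℝ/ℤ`, consecutive arcs meeting only at shared endpoints. -/
theorem rInterval_circle_decomposition (N : ℕ) (hN : 1 ≤ N) (c : ℕ → TColor)
    (hc : ∀ i < 2 * N, c ((i + 1) % (2 * N)) ≠ c i) :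
    ∃ s : ℕ → ℝ, s (2 * N) = s 0 + 1 ∧
      (∀ i < 2 * N, IsRInterval (s i) (s (i + 1))) ∧
      (∀ i < 2 * N, HasTColor (c i) (tc (s i))) ∧
      (⋃ i ∈ Finset.range (2 * N), cArc (s i) (s (i + 1))) = Set.univ := by
  cases h0 : c 0 with
  | blue =>
    have hcol := color_eq_of_alternating (v := TColor.red) (by simp) hc h0
    have hend : cyclicPt N (2 * N) = cyclicPt N 0 + 1 := by
      rw [cyclicPt, cyclicPt, if_neg (by omega), if_pos rfl, if_pos (by omega)]
      simp [triadicPt]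
    refine ⟨cyclicPt N, hend, fun i hi => isRInterval_cyclicPt (by omega), fun i hi => ?_,
      biUnion_cArc_eq_univ _ (by omega) hend⟩
    rw [hcol i hi]
    split_ifs with h
    · exact blueT_cyclicPt hi.le h
    · exact redT_cyclicPt hi.le (by omega)
  | red =>
    have hcol := color_eq_of_alternating (v := TColor.blue) (by simp) hc h0
    have hend : cyclicPt N (2 * N + 1) = cyclicPt N (0 + 1) + 1 := by
      rw [cyclicPt, cyclicPt, if_neg (by omega), if_neg (by omega), if_pos (by omega)]
      norm_num [triadicPt]
    refine ⟨fun i => cyclicPt N (i + 1), hend, fun i hi => isRInterval_cyclicPt (by omega),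
      fun i hi => ?_, biUnion_cArc_eq_univ (fun i => cyclicPt N (i + 1)) (by omega) hend⟩
    rw [hcol i hi]
    split_ifs with h
    · exact redT_cyclicPt (by omega) (by omega)
    · exact blueT_cyclicPt (by omega) (by omega)
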